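/- Let ψ₁ ∈ T_1 have the integral representation ψ₁(s) = c₀ + ∫₀^∞ (e^{su} − 1) dμ₁(u), and suppose ω := ∫₀^∞ u dμ₁(u) < ∞. Then the function ψ(s₁,s₂) := (ψ₁(s₁) − ψ₁(s₂))/(s₁ − s₂) − ω for s₁ ≠ s₂ (with ψ(s₁,s₁) := ψ₁′(s₁) − ω) belongs to T_2 and has the integral representation ψ(s₁,s₂) = ∫₀^∞∫₀^∞ (e^{s₁u₁+s₂u₂} − 1) dμ(u₁,u₂), where μ is the image of the measure dμ₁(v) dw on the region {(v,w) : v ≥ 0, −v ≤ w ≤ v} under the map u₁ = (v+w)/2, u₂ = (v−w)/2 (with the factor 1/2 from the Jacobian). -/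

import Mathlib

open MeasureTheory Filter Set

noncomputable section

/-- The open negative orthant `(-∞,0)^n`. -/
def negOrthant (n : ℕ) : Set (Fin n → ℝ) := {s | ∀ i, s i < 0}

/-- `f` is absolutely monotone on `(-∞,0)^n`: it is `C^∞` there and all its
iterated partial derivatives (of all orders, including order `0`) are nonnegative. -/
def AbsMono (n : ℕ) (f : (Fin n → ℝ) → ℝ) : Prop :=
  ContDiffOn ℝ (⊤ : ℕ∞) f (negOrthant n) ∧
  ∀ (k : ℕ) (m : Fin k → Fin n), ∀ x ∈ negOrthant n,
    0 ≤ iteratedFDerivWithin ℝ k f (negOrthant n) x (fun i => Pi.single (m i) 1)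

/-- `ψ` belongs to the class `T_n`: it is a nonpositive `C^∞` function on `(-∞,0)^n`
all of whose partial derivatives of every order `≥ 1` are nonnegative. -/
def MemT (n : ℕ) (ψ : (Fin n → ℝ) → ℝ) : Prop :=
  ContDiffOn ℝ (⊤ : ℕ∞) ψ (negOrthant n) ∧
  (∀ x ∈ negOrthant n, ψ x ≤ 0) ∧
  ∀ (k : ℕ) (m : Fin (k + 1) → Fin n), ∀ x ∈ negOrthant n,
    0 ≤ iteratedFDerivWithin ℝ (k + 1) ψ (negOrthant n) x (fun i => Pi.single (m i) 1)

/-- `ℝ₊ⁿ ∖ {0}`. -/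
def posPart (n : ℕ) : Set (Fin n → ℝ) := {u | (∀ i, 0 ≤ u i) ∧ u ≠ 0}

/-- `[0,δ)ⁿ ∖ {0}`. -/
def smallBox (n : ℕ) (δ : ℝ) : Set (Fin n → ℝ) := {u | (∀ i, 0 ≤ u i ∧ u i < δ) ∧ u ≠ 0}

/-- `ℝ₊ⁿ ∖ [0,δ)ⁿ`. -/
def farPart (n : ℕ) (δ : ℝ) : Set (Fin n → ℝ) := {u | (∀ i, 0 ≤ u i) ∧ ¬ ∀ i, u i < δ}

/-- The conditions on the representing measure: for sufficiently small `δ > 0`,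
the coordinate functions are integrable on `[0,δ)ⁿ ∖ {0}` and
`μ(ℝ₊ⁿ ∖ [0,δ)ⁿ) < ∞`. -/
def GoodMeasure (n : ℕ) (μ : Measure (Fin n → ℝ)) : Prop :=
  ∃ δ > (0:ℝ), (∀ j, IntegrableOn (fun u => u j) (smallBox n δ) μ) ∧ μ (farPart n δ) < ⊤

/-- `f` is absolutely monotone on `(-∞,0)`: it is `C^∞` there and all of its
derivatives (of all orders, including order `0`) are nonnegative there. -/
def AbsMono1 (f : ℝ → ℝ) : Prop :=
  ContDiffOn ℝ (⊤ : ℕ∞) f (Set.Iio 0) ∧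
  ∀ (k : ℕ), ∀ x < (0:ℝ), 0 ≤ iteratedDerivWithin k f (Set.Iio 0) x

/-- `ψ` belongs to the class `T_1`: it is a nonpositive `C^∞` function on `(-∞,0)`
whose derivative is absolutely monotone, i.e. all derivatives of order `≥ 1`
are nonnegative on `(-∞,0)`. -/
def MemT1 (ψ : ℝ → ℝ) : Prop :=
  ContDiffOn ℝ (⊤ : ℕ∞) ψ (Set.Iio 0) ∧ (∀ x < (0:ℝ), ψ x ≤ 0) ∧
  ∀ (k : ℕ), ∀ x < (0:ℝ), 0 ≤ iteratedDerivWithin (k + 1) ψ (Set.Iio 0) x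

open Topology

theorem isOpen_negOrthant (n : ℕ) : IsOpen (negOrthant n) := by
  simp only [negOrthant, ofPred_forall]
  exact isOpen_iInter_of_finite fun i => isOpen_lt (continuous_apply i) continuous_const

/-- The monomial-weighted exponential kernel `∏_{i ∈ l} uᵢ · exp ⟨s, u⟩`. -/
def expKernel {n : ℕ} (l : List (Fin n)) (s u : Fin n → ℝ) : ℝ :=
  (l.map u).prod * Real.exp (∑ i, s i * u i)

theorem expKernel_nonneg {n : ℕ} (l : List (Fin n)) (s : Fin n → ℝ) {u : Fin n → ℝ}
    (hu : ∀ i, 0 ≤ u i) : 0 ≤ expKernel l s u := by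
  refine mul_nonneg (List.prod_nonneg ?_) (Real.exp_nonneg _)
  simp only [List.mem_map, forall_exists_index, and_imp, forall_apply_eq_imp_iff₂]
  exact fun i _ => hu i

theorem continuous_expKernel {n : ℕ} (l : List (Fin n)) (s : Fin n → ℝ) :
    Continuous (expKernel l s) := by
  unfold expKernel
  have : Continuous fun u : Fin n → ℝ => (l.map u).prod := by
    induction l with
    | nil => simpa using continuous_const
    | cons i l ih =>
      simp only [List.map_cons, List.prod_cons]
      fun_prop
  fun_prop

theorem expKernel_le {n : ℕ} (l : List (Fin n)) {ε : ℝ} (hε : 0 < ε) {s u : Fin n → ℝ}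
    (hs : ∀ i, s i ≤ -ε) (hu : ∀ i, 0 ≤ u i) :
    expKernel l s u ≤ l.length.factorial / ε ^ l.length := by
  set S := ∑ i, u i with hS
  have hS0 : 0 ≤ S := Finset.sum_nonneg fun i _ => hu i
  have hprod : (l.map u).prod ≤ S ^ l.length := by
    induction l with
    | nil => simp
    | cons i l ih =>
      simp only [List.map_cons, List.prod_cons, List.length_cons, pow_succ']
      exact mul_le_mul (Finset.single_le_sum (fun j _ => hu j) (Finset.mem_univ i)) ih
        (List.prod_nonneg (by
          simp only [List.mem_map, forall_exists_index, and_imp, forall_apply_eq_imp_iff₂]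
          exact fun i _ => hu i)) hS0
  have hexp : ∑ i, s i * u i ≤ -(ε * S) := by
    rw [hS, Finset.mul_sum, ← Finset.sum_neg_distrib]
    refine Finset.sum_le_sum fun i _ => ?_
    nlinarith [hs i, hu i]
  have hpow := Real.pow_div_factorial_le_exp (x := ε * S) (by positivity) l.length
  calc expKernel l s u ≤ S ^ l.length * Real.exp (-(ε * S)) := by
        unfold expKernel; gcongr
    _ ≤ l.length.factorial / ε ^ l.length := by
        rw [Real.exp_neg, ← div_eq_mul_inv, div_le_div_iff₀ (Real.exp_pos _) (by positivity)]
        rw [div_le_iff₀ (by positivity), mul_pow] at hpow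
        linarith

theorem hasFDerivAt_expKernel {n : ℕ} (l : List (Fin n)) (s u : Fin n → ℝ) :
    HasFDerivAt (fun s => expKernel l s u)
      (∑ j, expKernel (j :: l) s u • ContinuousLinearMap.proj (R := ℝ) (φ := fun _ => ℝ) j) s := by
  have h : HasFDerivAt (fun s : Fin n → ℝ => ∑ i, s i * u i)
      (∑ j, u j • ContinuousLinearMap.proj (R := ℝ) (φ := fun _ => ℝ) j) s :=
    HasFDerivAt.fun_sum fun i _ => (hasFDerivAt_apply i s).mul_const (u i)
  refine (h.exp.const_mul (l.map u).prod).congr_fderiv ?_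
  simp only [Finset.smul_sum, smul_smul]
  refine Finset.sum_congr rfl fun j _ => ?_
  congr 1
  simp only [expKernel, List.map_cons, List.prod_cons]
  ring

theorem exists_forall_lt_neg {n : ℕ} {s : Fin n → ℝ} (hs : s ∈ negOrthant n) :
    ∃ ε > 0, ∀ i, s i < -ε := by
  have h : ∀ᶠ ε : ℝ in 𝓝[>] 0, ∀ i, s i < -ε := by
    rw [eventually_all]
    intro i
    filter_upwards [nhdsWithin_le_nhds (eventually_lt_nhds (b := -s i) (by linarith [hs i]))]
      with ε hε
    linarith
  obtain ⟨ε, hε, h0⟩ := (h.and self_mem_nhdsWithin).exists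
  exact ⟨ε, h0, hε⟩

section Laplace

variable {n : ℕ} {ν : Measure (Fin n → ℝ)} [IsFiniteMeasure ν]

theorem integrable_expKernel (hν : ∀ᵐ u ∂ν, ∀ i, 0 ≤ u i) (l : List (Fin n))
    {s : Fin n → ℝ} (hs : s ∈ negOrthant n) : Integrable (expKernel l s) ν := by
  obtain ⟨ε, hε, hsε⟩ := exists_forall_lt_neg hs
  refine Integrable.of_bound (continuous_expKernel l s).aestronglyMeasurable
    (l.length.factorial / ε ^ l.length) ?_
  filter_upwards [hν] with u hu
  rw [Real.norm_of_nonneg (expKernel_nonneg l s hu)]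
  exact expKernel_le l hε (fun i => (hsε i).le) hu

theorem hasFDerivAt_integral_expKernel (hν : ∀ᵐ u ∂ν, ∀ i, 0 ≤ u i) (l : List (Fin n))
    {s : Fin n → ℝ} (hs : s ∈ negOrthant n) :
    HasFDerivAt (fun s => ∫ u, expKernel l s u ∂ν)
      (∑ j, (∫ u, expKernel (j :: l) s u ∂ν) •
        ContinuousLinearMap.proj (R := ℝ) (φ := fun _ => ℝ) j) s := by
  obtain ⟨ε, hε, hsε⟩ := exists_forall_lt_neg hs
  have hnhds : {x : Fin n → ℝ | ∀ i, x i < -ε} ∈ 𝓝 s := by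
    refine IsOpen.mem_nhds ?_ hsε
    simp only [ofPred_forall]
    exact isOpen_iInter_of_finite fun i => isOpen_lt (continuous_apply i) continuous_const
  have key := hasFDerivAt_integral_of_dominated_of_fderiv_le (μ := ν) (𝕜 := ℝ)
    (F := fun s u => expKernel l s u)
    (F' := fun s u => ∑ j, expKernel (j :: l) s u •
      ContinuousLinearMap.proj (R := ℝ) (φ := fun _ => ℝ) j)
    (bound := fun _ => ∑ j : Fin n, ((l.length + 1).factorial / ε ^ (l.length + 1)) *
      ‖ContinuousLinearMap.proj (R := ℝ) (φ := fun _ : Fin n => ℝ) j‖)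
    hnhds
    (Eventually.of_forall fun x => (continuous_expKernel l x).aestronglyMeasurable)
    (integrable_expKernel hν l hs)
    (Continuous.aestronglyMeasurable (continuous_finsetSum _ fun j _ =>
      (continuous_expKernel (j :: l) s).smul continuous_const))
    (by
      filter_upwards [hν] with u hu x hx
      refine norm_sum_le_of_le _ fun j _ => ?_
      rw [norm_smul, Real.norm_of_nonneg (expKernel_nonneg _ x hu)]
      gcongr
      exact expKernel_le (j :: l) hε (fun i => (hx i).le) hu)
    (integrable_const _)
    (Eventually.of_forall fun u x _ => hasFDerivAt_expKernel l x u)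
  refine key.congr_fderiv ?_
  rw [integral_finsetSum _ fun j _ => (integrable_expKernel hν (j :: l) hs).smul_const _]
  simp only [integral_smul_const]

theorem contDiffOn_integral_expKernel (hν : ∀ᵐ u ∂ν, ∀ i, 0 ≤ u i) (l : List (Fin n)) :
    ContDiffOn ℝ (⊤ : ℕ∞) (fun s => ∫ u, expKernel l s u ∂ν) (negOrthant n) := by
  rw [contDiffOn_infty]
  intro k
  induction k generalizing l with
  | zero =>
    exact contDiffOn_zero.2 fun s hs =>
      (hasFDerivAt_integral_expKernel hν l hs).continuousAt.continuousWithinAt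
  | succ k ih =>
    push_cast
    refine (contDiffOn_succ_iff_fderiv_of_isOpen (isOpen_negOrthant n)).2
      ⟨fun s hs => (hasFDerivAt_integral_expKernel hν l hs).differentiableAt.differentiableWithinAt,
        by simp, ?_⟩
    refine ContDiffOn.congr (ContDiffOn.sum (s := Finset.univ) fun j _ =>
      (ih (j :: l)).smul contDiffOn_const)
      fun s hs => (hasFDerivAt_integral_expKernel hν l hs).fderiv

theorem iteratedFDerivWithin_integral_expKernel (hν : ∀ᵐ u ∂ν, ∀ i, 0 ≤ u i)
    (l : List (Fin n)) {k : ℕ} (m : Fin k → Fin n) {s : Fin n → ℝ} (hs : s ∈ negOrthant n) :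
    iteratedFDerivWithin ℝ k (fun s => ∫ u, expKernel l s u ∂ν) (negOrthant n) s
      (fun i => Pi.single (m i) 1) = ∫ u, expKernel (List.ofFn m ++ l) s u ∂ν := by
  have huniq := (isOpen_negOrthant n).uniqueDiffOn (𝕜 := ℝ)
  induction k generalizing s with
  | zero => simp
  | succ k ih =>
    have hdiff := (contDiffOn_integral_expKernel hν l).differentiableOn_iteratedFDerivWithin
      (m := k) (by exact_mod_cast WithTop.coe_lt_top k) huniq s hs
    have happ := fderivWithin_continuousMultilinear_apply_const (huniq s hs) hdiff
      (fun i => Pi.single (m i.succ) (1 : ℝ))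
    rw [fderivWithin_congr (fun x hx => ih (fun i => m i.succ) hx) (ih (fun i => m i.succ) hs),
      ((hasFDerivAt_integral_expKernel hν _ hs).hasFDerivWithinAt).fderivWithin (huniq s hs)]
      at happ
    have := DFunLike.congr_fun happ (Pi.single (m 0) (1 : ℝ))
    rw [iteratedFDerivWithin_succ_apply_left]
    refine this.symm.trans ?_
    simp [Pi.single_apply, List.ofFn_succ]

theorem memT_integral_expKernel_sub (hν : ∀ᵐ u ∂ν, ∀ i, 0 ≤ u i) :
    MemT n (fun s => (∫ u, expKernel [] s u ∂ν) - ν.real univ) := by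
  have hcd := contDiffOn_integral_expKernel hν []
  refine ⟨hcd.sub contDiffOn_const, fun s hs => ?_, fun k m s hs => ?_⟩
  · rw [sub_nonpos, ← mul_one (ν.real univ), ← smul_eq_mul, ← integral_const]
    refine integral_mono_ae (integrable_expKernel hν [] hs) (integrable_const _) ?_
    filter_upwards [hν] with u hu
    simp only [expKernel, List.map_nil, List.prod_nil, one_mul, Real.exp_le_one_iff]
    exact Finset.sum_nonpos fun i _ => mul_nonpos_of_nonpos_of_nonneg (hs i).le (hu i)
  · rw [fun_iteratedFDerivWithin_sub_apply ((hcd s hs).of_le (by exact_mod_cast le_top))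
      contDiffWithinAt_const (isOpen_negOrthant n).uniqueDiffOn hs,
      iteratedFDerivWithin_succ_const, Pi.zero_apply, sub_zero,
      iteratedFDerivWithin_integral_expKernel hν [] m hs]
    exact integral_nonneg_of_ae (hν.mono fun u hu => expKernel_nonneg _ s hu)

end Laplace

theorem MemT.congr {n : ℕ} {f g : (Fin n → ℝ) → ℝ} (hf : MemT n f)
    (h : EqOn g f (negOrthant n)) : MemT n g := by
  refine ⟨hf.1.congr h, fun x hx => (h hx).trans_le (hf.2.1 x hx), fun k m x hx => ?_⟩
  rw [iteratedFDerivWithin_congr h hx]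
  exact hf.2.2 k m x hx

/-- The region `{(v, w) : v ≥ 0, -v ≤ w ≤ v}`. -/
def wedge : Set (ℝ × ℝ) := {p | 0 ≤ p.1 ∧ -p.1 ≤ p.2 ∧ p.2 ≤ p.1}

theorem measurableSet_wedge : MeasurableSet wedge :=
  ((isClosed_le continuous_const continuous_fst).inter
    ((isClosed_le continuous_fst.neg continuous_snd).inter
      (isClosed_le continuous_snd continuous_fst))).measurableSet

theorem preimage_mk_wedge (v : ℝ) : Prod.mk v ⁻¹' wedge = Icc (-v) v := by
  ext w
  simp only [wedge, mem_preimage, mem_ofPred_eq, mem_Icc, and_iff_right_iff_imp, and_imp]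
  intro h₁ h₂
  linarith

theorem prod_wedge_lt_top {μ₁ : Measure ℝ}
    (h : IntegrableOn (fun u => u) (Ioi (0 : ℝ)) μ₁) :
    (μ₁.prod volume) wedge < ⊤ := by
  rw [Measure.prod_apply measurableSet_wedge]
  simp only [preimage_mk_wedge, Real.volume_Icc]
  have hsupp : Function.support (fun v : ℝ => ENNReal.ofReal (v - -v)) ⊆ Ioi 0 := by
    intro v hv
    have := ENNReal.ofReal_pos.1 (pos_iff_ne_zero.2 hv)
    simp only [mem_Ioi]
    linarith
  rw [← setLIntegral_eq_of_support_subset hsupp]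
  refine lt_of_le_of_lt (lintegral_mono fun v => ?_) ((h.add h).lintegral_lt_top)
  simp

theorem setIntegral_wedge {μ₁ : Measure ℝ} [SigmaFinite μ₁] {g : ℝ × ℝ → ℝ}
    (hg : IntegrableOn g wedge (μ₁.prod volume)) :
    ∫ p in wedge, g p ∂(μ₁.prod volume) =
      ∫ v in Ioi (0 : ℝ), (∫ w in (-v)..v, g (v, w)) ∂μ₁ := by
  have hinner (v : ℝ) : ∫ w, wedge.indicator g (v, w) = ∫ w in Icc (-v) v, g (v, w) := by
    rw [← preimage_mk_wedge, ← integral_indicator (measurable_prodMk_left measurableSet_wedge)]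
    rfl
  rw [← integral_indicator measurableSet_wedge,
    integral_prod _ ((integrable_indicator_iff measurableSet_wedge).2 hg)]
  simp only [hinner]
  rw [← setIntegral_eq_integral_of_forall_compl_eq_zero (s := Ioi (0 : ℝ))]
  · refine setIntegral_congr_fun measurableSet_Ioi fun v hv => ?_
    rw [mem_Ioi] at hv
    rw [intervalIntegral.integral_of_le (by linarith), integral_Icc_eq_integral_Ioc]
  · intro v hv
    rw [mem_Ioi, not_lt] at hv
    refine setIntegral_measure_zero _ ?_
    rw [Real.volume_Icc, ENNReal.ofReal_eq_zero]
    linarith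

theorem intervalIntegral_exp_sub_one_of_ne {a b : ℝ} (hab : a ≠ b) (v : ℝ) :
    ∫ w in (-v)..v, (Real.exp (a * ((v + w) / 2) + b * ((v - w) / 2)) - 1) =
      2 * ((Real.exp (a * v) - Real.exp (b * v)) / (a - b) - v) := by
  have hab' : a - b ≠ 0 := sub_ne_zero.2 hab
  rw [intervalIntegral.integral_eq_sub_of_hasDerivAt
    (f := fun w => 2 / (a - b) * Real.exp (a * ((v + w) / 2) + b * ((v - w) / 2)) - w)
    (fun w _ => ?_) (Continuous.intervalIntegrable (by fun_prop) _ _)]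
  · have h₁ : a * ((v + v) / 2) + b * ((v - v) / 2) = a * v := by ring
    have h₂ : a * ((v + -v) / 2) + b * ((v - -v) / 2) = b * v := by ring
    rw [h₁, h₂]
    ring
  · have h₁ : HasDerivAt (fun w : ℝ => (v + w) / 2) (1 / 2) w :=
      ((hasDerivAt_id w).const_add v).div_const 2
    have h₂ : HasDerivAt (fun w : ℝ => (v - w) / 2) (-1 / 2) w :=
      ((hasDerivAt_id w).const_sub v).div_const 2
    refine ((((h₁.const_mul a).add (h₂.const_mul b)).exp.const_mul (2 / (a - b))).sub
      (hasDerivAt_id w)).congr_deriv ?_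
    simp only [Pi.add_apply]
    field_simp
    ring

theorem intervalIntegral_exp_sub_one_self (a v : ℝ) :
    ∫ w in (-v)..v, (Real.exp (a * ((v + w) / 2) + a * ((v - w) / 2)) - 1) =
      2 * (v * Real.exp (a * v) - v) := by
  have h (w : ℝ) : a * ((v + w) / 2) + a * ((v - w) / 2) = a * v := by ring
  simp only [h, intervalIntegral.integral_const, smul_eq_mul]
  ring

theorem hasDerivAt_integral_exp_sub_one {μ₁ : Measure ℝ} {a : ℝ} (ha : a < 0)
    (hint : IntegrableOn (fun u => Real.exp (a * u) - 1) (Ioi (0 : ℝ)) μ₁)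
    (hid : IntegrableOn (fun u => u) (Ioi (0 : ℝ)) μ₁) :
    IntegrableOn (fun u => u * Real.exp (a * u)) (Ioi (0 : ℝ)) μ₁ ∧
      HasDerivAt (fun s => ∫ u in Ioi (0 : ℝ), (Real.exp (s * u) - 1) ∂μ₁)
        (∫ u in Ioi (0 : ℝ), u * Real.exp (a * u) ∂μ₁) a := by
  refine hasDerivAt_integral_of_dominated_loc_of_deriv_le (μ := μ₁.restrict (Ioi 0))
    (s := Iio 0) (bound := fun u => u) (F := fun s u => Real.exp (s * u) - 1)
    (F' := fun s u => u * Real.exp (s * u)) (Iio_mem_nhds ha)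
    (Eventually.of_forall fun s => Continuous.aestronglyMeasurable (by fun_prop)) hint
    (Continuous.aestronglyMeasurable (by fun_prop)) ?_ hid
    (Eventually.of_forall fun u s _ => ?_)
  · filter_upwards [ae_restrict_mem measurableSet_Ioi] with u hu s hs
    rw [mem_Ioi] at hu
    rw [mem_Iio] at hs
    rw [Real.norm_of_nonneg (by positivity)]
    exact mul_le_of_le_one_right hu.le
      (Real.exp_le_one_iff.2 (mul_nonpos_of_nonpos_of_nonneg hs.le hu.le))
  · refine (((hasDerivAt_id s).mul_const u).exp.sub_const 1).congr_deriv ?_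
    simp only [id]
    ring

/-- The image of `dμ₁(v) dw / 2` on the wedge under `(v, w) ↦ ((v + w) / 2, (v - w) / 2)`. -/
def wedgeImage (μ₁ : Measure ℝ) : Measure (ℝ × ℝ) :=
  (2 : ENNReal)⁻¹ • Measure.map (fun p : ℝ × ℝ => ((p.1 + p.2) / 2, (p.1 - p.2) / 2))
    ((μ₁.prod volume).restrict wedge)

theorem isFiniteMeasure_wedgeImage {μ₁ : Measure ℝ} [SigmaFinite μ₁]
    (h : IntegrableOn (fun u => u) (Ioi (0 : ℝ)) μ₁) : IsFiniteMeasure (wedgeImage μ₁) := by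
  have : IsFiniteMeasure ((μ₁.prod volume).restrict wedge) :=
    isFiniteMeasure_restrict.2 (prod_wedge_lt_top h).ne
  exact Measure.smul_finite _ (by simp)

theorem ae_wedgeImage_nonneg (μ₁ : Measure ℝ) : ∀ᵐ u ∂wedgeImage μ₁, 0 ≤ u.1 ∧ 0 ≤ u.2 := by
  refine Measure.ae_smul_measure ?_ _
  refine (ae_map_iff (by fun_prop) ?_).2 ?_
  · exact ((isClosed_le continuous_const continuous_fst).inter
      (isClosed_le continuous_const continuous_snd)).measurableSet
  · filter_upwards [ae_restrict_mem measurableSet_wedge] with p hp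
    obtain ⟨_, h₁, h₂⟩ := hp
    exact ⟨by linarith, by linarith⟩

theorem integrable_exp_wedgeImage {μ₁ : Measure ℝ} [SigmaFinite μ₁]
    (h : IntegrableOn (fun u => u) (Ioi (0 : ℝ)) μ₁) {a b : ℝ} (ha : a < 0) (hb : b < 0) :
    Integrable (fun u : ℝ × ℝ => Real.exp (a * u.1 + b * u.2)) (wedgeImage μ₁) := by
  have := isFiniteMeasure_wedgeImage h
  refine Integrable.of_bound (Continuous.aestronglyMeasurable (by fun_prop)) 1 ?_
  filter_upwards [ae_wedgeImage_nonneg μ₁] with u hu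
  rw [Real.norm_of_nonneg (Real.exp_nonneg _), Real.exp_le_one_iff]
  nlinarith [hu.1, hu.2]

theorem integral_exp_sub_one_wedgeImage {μ₁ : Measure ℝ} [SigmaFinite μ₁]
    (h : IntegrableOn (fun u => u) (Ioi (0 : ℝ)) μ₁) {a b : ℝ} (ha : a < 0) (hb : b < 0) :
    ∫ u, (Real.exp (a * u.1 + b * u.2) - 1) ∂wedgeImage μ₁ =
      2⁻¹ * ∫ v in Ioi (0 : ℝ),
        (∫ w in (-v)..v, (Real.exp (a * ((v + w) / 2) + b * ((v - w) / 2)) - 1)) ∂μ₁ := by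
  have := isFiniteMeasure_wedgeImage h
  have hint := (integrable_exp_wedgeImage h ha hb).sub (integrable_const (1 : ℝ))
  have hcont : Continuous fun u : ℝ × ℝ => Real.exp (a * u.1 + b * u.2) - 1 := by fun_prop
  have hT : Measurable fun p : ℝ × ℝ => ((p.1 + p.2) / 2, (p.1 - p.2) / 2) := by fun_prop
  rw [wedgeImage, integrable_smul_measure (by simp) (by simp)] at hint
  rw [wedgeImage, integral_smul_measure, integral_map hT.aemeasurable
    hcont.aestronglyMeasurable, setIntegral_wedge]
  · simp
  · exact (integrable_map_measure hcont.aestronglyMeasurable hT.aemeasurable).1 hint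

theorem memT_integral_exp_sub_one {μ : Measure (ℝ × ℝ)} [IsFiniteMeasure μ]
    (hμ : ∀ᵐ u ∂μ, 0 ≤ u.1 ∧ 0 ≤ u.2) :
    MemT 2 fun s => ∫ u : ℝ × ℝ, (Real.exp (s 0 * u.1 + s 1 * u.2) - 1) ∂μ := by
  let T : ℝ × ℝ → Fin 2 → ℝ := fun u => ![u.1, u.2]
  have hT : Measurable T := by
    refine measurable_pi_lambda _ fun i => ?_
    fin_cases i
    · exact measurable_fst
    · exact measurable_snd
  have hν : ∀ᵐ u ∂μ.map T, ∀ i, 0 ≤ u i := by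
    refine (ae_map_iff hT.aemeasurable ?_).2 ?_
    · simp only [ofPred_forall]
      exact MeasurableSet.iInter fun i =>
        (isClosed_le continuous_const (continuous_apply i)).measurableSet
    · filter_upwards [hμ] with u hu
      simpa [Fin.forall_fin_two, T] using hu
  refine (memT_integral_expKernel_sub hν).congr fun s hs => ?_
  have hker := integrable_expKernel hν [] hs
  have hmeas := (continuous_expKernel [] s).aestronglyMeasurable (μ := μ.map T)
  have heq (u : ℝ × ℝ) : expKernel [] s (T u) = Real.exp (s 0 * u.1 + s 1 * u.2) := by
    simp [expKernel, T]
  have hint := (integrable_map_measure hmeas hT.aemeasurable).1 hker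
  simp only [Function.comp_def, heq] at hint
  beta_reduce
  rw [integral_map hT.aemeasurable hmeas, map_measureReal_apply hT MeasurableSet.univ]
  simp only [heq]
  rw [integral_sub hint (integrable_const _)]
  simp

/-- Theorem 5: if `ψ₁ ∈ T_1` has the representation
`ψ₁(s) = c₀ + ∫₀^∞ (e^{su} − 1) dμ₁(u)` with `ω := ∫₀^∞ u dμ₁(u) < ∞`, then
`ψ(s₁,s₂) := (ψ₁(s₁) − ψ₁(s₂))/(s₁ − s₂) − ω` (with value `ψ₁′(s₁) − ω` on the
diagonal) belongs to `T_2` and has the representation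
`ψ(s₁,s₂) = ∫₀^∞∫₀^∞ (e^{s₁u₁+s₂u₂} − 1) dμ(u₁,u₂)`, where `μ` is the image of
`(1/2)·dμ₁(v) dw` on `{(v,w) : v ≥ 0, −v ≤ w ≤ v}` under
`u₁ = (v+w)/2, u₂ = (v−w)/2`. -/
theorem divided_difference_memT2 (ψ₁ : ℝ → ℝ) (hψ₁ : MemT1 ψ₁) (c₀ : ℝ)
    (μ₁ : Measure ℝ) [SigmaFinite μ₁]
    (hrep : ∀ s < (0:ℝ),
      ψ₁ s = c₀ + ∫ u in Set.Ioi (0:ℝ), (Real.exp (s * u) - 1) ∂μ₁)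
    (hrepint : ∀ s < (0:ℝ),
      IntegrableOn (fun u => Real.exp (s * u) - 1) (Set.Ioi (0:ℝ)) μ₁)
    (ω : ℝ) (hω : ω = ∫ u in Set.Ioi (0:ℝ), u ∂μ₁)
    (hωint : IntegrableOn (fun u => u) (Set.Ioi (0:ℝ)) μ₁)
    (ψ : (Fin 2 → ℝ) → ℝ)
    (hψ : ∀ s : Fin 2 → ℝ,
      ψ s = if s 0 = s 1 then derivWithin ψ₁ (Set.Iio 0) (s 0) - ω
        else (ψ₁ (s 0) - ψ₁ (s 1)) / (s 0 - s 1) - ω)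
    (μ : Measure (ℝ × ℝ))
    (hμ : μ = (2 : ENNReal)⁻¹ •
      Measure.map (fun p : ℝ × ℝ => ((p.1 + p.2) / 2, (p.1 - p.2) / 2))
        ((μ₁.prod volume).restrict {p : ℝ × ℝ | 0 ≤ p.1 ∧ -p.1 ≤ p.2 ∧ p.2 ≤ p.1})) :
    MemT 2 ψ ∧
    ∀ s ∈ negOrthant 2,
      Integrable (fun u : ℝ × ℝ => Real.exp (s 0 * u.1 + s 1 * u.2) - 1) μ ∧
      ψ s = ∫ u : ℝ × ℝ, (Real.exp (s 0 * u.1 + s 1 * u.2) - 1) ∂μ := by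
  have hμ' : μ = wedgeImage μ₁ := hμ
  have hfin : IsFiniteMeasure μ := hμ' ▸ isFiniteMeasure_wedgeImage hωint
  have hrepr : ∀ s ∈ negOrthant 2,
      ψ s = ∫ u : ℝ × ℝ, (Real.exp (s 0 * u.1 + s 1 * u.2) - 1) ∂μ := by
    intro s hs
    rw [hμ', integral_exp_sub_one_wedgeImage hωint (hs 0) (hs 1), hψ]
    split_ifs with h
    · have hderiv := hasDerivAt_integral_exp_sub_one (hs 0) (hrepint _ (hs 0)) hωint
      have hψ₁' : HasDerivAt ψ₁ (∫ u in Ioi (0 : ℝ), u * Real.exp (s 0 * u) ∂μ₁) (s 0) := by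
        refine (hderiv.2.const_add c₀).congr_of_eventuallyEq ?_
        filter_upwards [Iio_mem_nhds (hs 0)] with x hx
        exact hrep x hx
      simp only [← h, intervalIntegral_exp_sub_one_self]
      rw [hψ₁'.hasDerivWithinAt.derivWithin (uniqueDiffOn_Iio 0 _ (hs 0)), hω,
        integral_const_mul, integral_sub hderiv.1 hωint]
      ring
    · have hsub : ψ₁ (s 0) - ψ₁ (s 1) =
          ∫ u in Ioi (0 : ℝ), (Real.exp (s 0 * u) - Real.exp (s 1 * u)) ∂μ₁ := by
        rw [hrep _ (hs 0), hrep _ (hs 1), add_sub_add_left_eq_sub,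
          ← integral_sub (hrepint _ (hs 0)) (hrepint _ (hs 1))]
        simp
      have hint : IntegrableOn (fun u => Real.exp (s 0 * u) - Real.exp (s 1 * u))
          (Ioi (0 : ℝ)) μ₁ :=
        ((hrepint _ (hs 0)).sub (hrepint _ (hs 1))).congr (Eventually.of_forall fun u => by simp)
      simp only [intervalIntegral_exp_sub_one_of_ne h]
      rw [hsub, hω, integral_const_mul, integral_sub (hint.div_const _) hωint, integral_div]
      ring
  refine ⟨(memT_integral_exp_sub_one (hμ' ▸ ae_wedgeImage_nonneg μ₁)).congr hrepr,
    fun s hs => ⟨?_, hrepr s hs⟩⟩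
  refine Integrable.sub ?_ (integrable_const 1)
  exact hμ' ▸ integrable_exp_wedgeImage hωint (hs 0) (hs 1)
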